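/- arXiv:2009.13725 — 3 statements merged into one kernel-verified Lean document; each statement's English description precedes it below -/
import Mathlib

section
/- Let $\mathcal{X} \subseteq \mathbb{R}^d$ be a compact convex set with diameter at most $R$, and let $f : \mathbb{R}^d \to \mathbb{R}$ be a convex function whose set of minimizers over $\mathcal{X}$ is nonempty, satisfying the acute angle condition on $\mathcal{X}$ with constant $\cos\phi > 0$ for some $\phi \in [0,\pi/2)$. Suppose the corruption probability satisfies $p < \cos\phi/(1+\cos\phi)$, fix $q \in [p, \cos\phi/(1+\cos\phi))$, set $\gamma = R / (2((1-q)\cos\phi - q))$ and step sizes $\gamma_t = \gamma/t$. Let $(x_t)_{t\ge 1}$ be the iterates of the normalized subgradient method under probabilistic corruption with these parameters, where each corruption indicator $Y_t$ is Bernoulli($p$) and independent of $x_t$. Then $\lim_{t\to\infty} \|x_t - x^\star(x_t)\|^2 = 0$ almost surely, i.e., the iterates converge almost surely to the set of minimizers of $f$ over $\mathcal{X}$. -/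
open MeasureTheory ProbabilityTheory Filter Topology Classical
open scoped InnerProductSpace

/-- A nonnegative sequence whose increments are dominated by a summable nonnegative sequence
converges. -/
theorem exists_tendsto_of_le_add_summable {D a : ℕ → ℝ} (hD : ∀ n, 0 ≤ D n) (ha : ∀ n, 0 ≤ a n)
    (hsum : Summable a) (hstep : ∀ n, D (n + 1) ≤ D n + a n) :
    ∃ L, Tendsto D atTop (𝓝 L) := by
  have hanti : Antitone fun n => D n - ∑ i ∈ Finset.range n, a i := by
    refine antitone_nat_of_succ_le fun n => ?_
    rw [Finset.sum_range_succ]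
    linarith [hstep n]
  have hbdd : BddBelow (Set.range fun n => D n - ∑ i ∈ Finset.range n, a i) := by
    refine ⟨-∑' i, a i, ?_⟩
    rintro _ ⟨n, rfl⟩
    have := hsum.sum_le_tsum (Finset.range n) fun i _ => ha i
    dsimp only
    linarith [hD n]
  refine ⟨_, ((tendsto_atTop_ciInf hanti hbdd).add hsum.hasSum.tendsto_sum_nat).congr fun n => ?_⟩
  ring

/-- A sequence `w ≥ 0` with `w n / (n + 1)` summable and squares almost nonincreasing tends to
zero. -/
theorem tendsto_sq_zero_of_summable_div {w : ℕ → ℝ} {γ : ℝ} (hγ : 0 < γ) (hw : ∀ n, 0 ≤ w n)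
    (hsum : Summable fun n : ℕ => γ / ((n : ℝ) + 1) * w n)
    (hstep : ∀ n : ℕ, w (n + 1) ^ 2 ≤
      w n ^ 2 + 2 * (γ / ((n : ℝ) + 1) * w n) + (γ / ((n : ℝ) + 1)) ^ 2)
    (hsq : Summable fun n : ℕ => (γ / ((n : ℝ) + 1)) ^ 2) :
    Tendsto (fun n => w n ^ 2) atTop (𝓝 0) := by
  obtain ⟨L, hL⟩ := exists_tendsto_of_le_add_summable (D := fun n => w n ^ 2)
    (a := fun n : ℕ => 2 * (γ / ((n : ℝ) + 1) * w n) + (γ / ((n : ℝ) + 1)) ^ 2)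
    (fun n => sq_nonneg _) (fun n => by have := hw n; positivity)
    ((hsum.mul_left 2).add hsq) (fun n => by linarith [hstep n])
  have hL0 : 0 ≤ L := ge_of_tendsto' hL fun n => sq_nonneg _
  rcases hL0.eq_or_lt with rfl | hpos
  · exact hL
  exfalso
  have hwlim : Tendsto w atTop (𝓝 (√L)) := by
    refine ((Real.continuous_sqrt.tendsto L).comp hL).congr fun n => ?_
    simp [Real.sqrt_sq (hw n)]
  have hev : ∀ᶠ n in atTop, √L / 2 < w n :=
    hwlim.eventually (lt_mem_nhds (half_lt_self (Real.sqrt_pos.2 hpos)))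
  have hs : Summable fun n : ℕ => γ / ((n : ℝ) + 1) * (√L / 2) := by
    refine Summable.of_norm_bounded_eventually_nat hsum ?_
    filter_upwards [hev] with n hn
    rw [Real.norm_of_nonneg (by positivity)]
    gcongr
  refine Real.not_summable_one_div_natCast ((summable_nat_add_iff 1).1 ?_)
  have hsL : 0 < √L := Real.sqrt_pos.2 hpos
  refine (hs.mul_left (2 / (γ * √L))).congr fun n => ?_
  push_cast
  field_simp

/-- Nonnegative integrable functions with summable integrals are almost everywhere summable. -/
theorem ae_summable_of_summable_integral {Ω : Type*} {mΩ : MeasurableSpace Ω} {μ : Measure Ω}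
    {F : ℕ → Ω → ℝ} (hF : ∀ n ω, 0 ≤ F n ω) (hint : ∀ n, Integrable (F n) μ)
    (hsum : Summable fun n => ∫ ω, F n ω ∂μ) :
    ∀ᵐ ω ∂μ, Summable fun n => F n ω := by
  have hmeas : ∀ n, AEMeasurable (fun ω => ENNReal.ofReal (F n ω)) μ :=
    fun n => (hint n).aemeasurable.ennreal_ofReal
  have hfin : ∫⁻ ω, ∑' n, ENNReal.ofReal (F n ω) ∂μ ≠ ⊤ := by
    rw [lintegral_tsum hmeas]
    simp_rw [← ofReal_integral_eq_lintegral_ofReal (hint _) (ae_of_all _ (hF _))]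
    exact hsum.tsum_ofReal_ne_top
  filter_upwards [ae_lt_top' (AEMeasurable.tsum hmeas) hfin] with ω hω
  refine (ENNReal.summable_toReal hω.ne).congr fun n => ?_
  exact ENNReal.toReal_ofReal (hF n ω)

theorem integrable_corruption_coeff {Ω : Type*} {mΩ : MeasurableSpace Ω} {μ : Measure Ω}
    [IsProbabilityMeasure μ] {Y : Ω → Bool} {c : ℝ} (hc : 0 ≤ c) (hYm : Measurable Y) :
    Integrable (fun ω => if Y ω = true then (-1 : ℝ) else c) μ := by
  have hcoef : Measurable fun y : Bool => if y = true then (-1 : ℝ) else c :=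
    measurable_of_finite _
  refine Integrable.of_bound (hcoef.comp hYm).aestronglyMeasurable (1 + c) (ae_of_all _ fun ω => ?_)
  split_ifs
  · rw [norm_neg, norm_one]; linarith
  · rw [Real.norm_of_nonneg hc]; linarith

theorem indepFun_corruption_coeff {Ω : Type*} {mΩ : MeasurableSpace Ω} {μ : Measure Ω}
    {Y : Ω → Bool} {w : Ω → ℝ} {c : ℝ} (hind : IndepFun Y w μ) :
    IndepFun (fun ω => if Y ω = true then (-1 : ℝ) else c) w μ :=
  hind.comp (φ := fun y : Bool => if y = true then (-1 : ℝ) else c)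
    (measurable_of_finite _) measurable_id

theorem integrable_corrupted_mul {Ω : Type*} {mΩ : MeasurableSpace Ω} {μ : Measure Ω}
    [IsProbabilityMeasure μ] {Y : Ω → Bool} {w : Ω → ℝ} {c : ℝ} (hc : 0 ≤ c)
    (hYm : Measurable Y) (hw : Integrable w μ) (hind : IndepFun Y w μ) :
    Integrable (fun ω => (if Y ω = true then (-1 : ℝ) else c) * w ω) μ :=
  (indepFun_corruption_coeff hind).integrable_mul (integrable_corruption_coeff hc hYm) hw

/-- The expected drift factorizes by independence of the corruption indicator. -/
theorem integral_corrupted_mul {Ω : Type*} {mΩ : MeasurableSpace Ω} {μ : Measure Ω}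
    [IsProbabilityMeasure μ] {Y : Ω → Bool} {w : Ω → ℝ} {c p : ℝ} (hc : 0 ≤ c) (hp : 0 ≤ p)
    (hYm : Measurable Y) (hYp : μ {ω | Y ω = true} = ENNReal.ofReal p)
    (hw : Integrable w μ) (hind : IndepFun Y w μ) :
    ∫ ω, (if Y ω = true then (-1 : ℝ) else c) * w ω ∂μ = ((1 - p) * c - p) * ∫ ω, w ω ∂μ := by
  have hset : MeasurableSet {ω | Y ω = true} := hYm (measurableSet_singleton true)
  have hfun : (fun ω => if Y ω = true then (-1 : ℝ) else c) =
      fun ω => c - (1 + c) * {ω | Y ω = true}.indicator 1 ω := by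
    ext ω
    by_cases hω : Y ω = true <;> simp [hω]
  have hi : Integrable ({ω | Y ω = true}.indicator (1 : Ω → ℝ)) μ :=
    (integrable_const 1).indicator hset
  have hcint : ∫ ω, (if Y ω = true then (-1 : ℝ) else c) ∂μ = (1 - p) * c - p := by
    rw [hfun, integral_sub (integrable_const c) (hi.const_mul _), integral_const_mul,
      integral_indicator_one hset, measureReal_def, hYp, ENNReal.toReal_ofReal hp]
    simp
    ring
  rw [← hcint]
  exact (indepFun_corruption_coeff hind).integral_fun_mul_eq_mul_integral
    (integrable_corruption_coeff hc hYm).aestronglyMeasurable hw.aestronglyMeasurable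

/-- Almost sure convergence to zero of a bounded process whose square drifts down, at rate
`c * w` on uncorrupted steps, and up, at rate at most `w`, on corrupted ones. -/
theorem ae_tendsto_sq_zero_of_corrupted_drift {Ω : Type*} {mΩ : MeasurableSpace Ω}
    {μ : Measure Ω} [IsProbabilityMeasure μ] {w : ℕ → Ω → ℝ} {Y : ℕ → Ω → Bool}
    {R c p γ : ℝ} (hγ : 0 < γ) (hc : 0 < c) (hp : 0 ≤ p) (hpc : p < (1 - p) * c)
    (hw0 : ∀ n ω, 0 ≤ w n ω) (hwR : ∀ n ω, w n ω ≤ R)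
    (hwm : ∀ n, Measurable (w n)) (hYm : ∀ n, Measurable (Y n))
    (hYp : ∀ n, μ {ω | Y n ω = true} = ENNReal.ofReal p)
    (hind : ∀ n, IndepFun (Y n) (w n) μ)
    (hstep : ∀ (n : ℕ) ω, w (n + 1) ω ^ 2 ≤ w n ω ^ 2
      - 2 * (γ / ((n : ℝ) + 1)) * ((if Y n ω = true then -1 else c) * w n ω)
      + (γ / ((n : ℝ) + 1)) ^ 2) :
    ∀ᵐ ω ∂μ, Tendsto (fun n => w n ω ^ 2) atTop (𝓝 0) := by
  have hsq : Summable fun n : ℕ => (γ / ((n : ℝ) + 1)) ^ 2 := by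
    have h := (summable_nat_add_iff 1).2
      (Real.summable_one_div_nat_pow.2 (one_lt_two : 1 < 2))
    refine (h.mul_left (γ ^ 2)).congr fun n => ?_
    push_cast
    rw [div_pow]
    ring
  have hwi : ∀ n, Integrable (w n) μ := fun n =>
    Integrable.of_bound (hwm n).aestronglyMeasurable R
      (ae_of_all _ fun ω => by rw [Real.norm_of_nonneg (hw0 n ω)]; exact hwR n ω)
  have hwi2 : ∀ n, Integrable (fun ω => w n ω ^ 2) μ := fun n =>
    Integrable.of_bound ((hwm n).pow_const 2).aestronglyMeasurable (R ^ 2)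
      (ae_of_all _ fun ω => by
        rw [Real.norm_of_nonneg (sq_nonneg _)]
        exact pow_le_pow_left₀ (hw0 n ω) (hwR n ω) 2)
  have hprodi := fun n => integrable_corrupted_mul hc.le (hYm n) (hwi n) (hind n)
  have hprod := fun n => integral_corrupted_mul hc.le hp (hYm n) (hYp n) (hwi n) (hind n)
  have hmean : ∀ n : ℕ, ∫ ω, w (n + 1) ω ^ 2 ∂μ ≤ ∫ ω, w n ω ^ 2 ∂μ
      - 2 * (γ / ((n : ℝ) + 1)) * (((1 - p) * c - p) * ∫ ω, w n ω ∂μ)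
      + (γ / ((n : ℝ) + 1)) ^ 2 := by
    intro n
    have hi1 := (hprodi n).const_mul (2 * (γ / ((n : ℝ) + 1)))
    have hle := integral_mono (hwi2 (n + 1))
      (((hwi2 n).sub hi1).add (integrable_const ((γ / ((n : ℝ) + 1)) ^ 2))) (hstep n)
    refine hle.trans_eq ?_
    rw [integral_add' ((hwi2 n).sub hi1) (integrable_const _), integral_sub' (hwi2 n) hi1,
      integral_const_mul, hprod]
    simp
  have hκ : 0 < (1 - p) * c - p := by linarith
  have hIsum : Summable fun n : ℕ => ∫ ω, γ / ((n : ℝ) + 1) * w n ω ∂μ := by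
    refine summable_of_sum_range_le (c := (∫ ω, w 0 ω ^ 2 ∂μ + ∑' n : ℕ, (γ / ((n : ℝ) + 1)) ^ 2) /
      (2 * ((1 - p) * c - p))) (fun n => integral_nonneg fun ω => ?_) fun N => ?_
    · exact mul_nonneg (by positivity) (hw0 n ω)
    have htele : ∀ N : ℕ, ∫ ω, w N ω ^ 2 ∂μ + 2 * ((1 - p) * c - p) *
        ∑ n ∈ Finset.range N, ∫ ω, γ / ((n : ℝ) + 1) * w n ω ∂μ ≤
        ∫ ω, w 0 ω ^ 2 ∂μ + ∑ n ∈ Finset.range N, (γ / ((n : ℝ) + 1)) ^ 2 := by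
      intro N
      induction N with
      | zero => simp
      | succ k ih =>
        rw [Finset.sum_range_succ, Finset.sum_range_succ, integral_const_mul]
        linarith [hmean k]
    rw [le_div_iff₀ (by positivity)]
    have h1 := htele N
    have h2 : 0 ≤ ∫ ω, w N ω ^ 2 ∂μ := integral_nonneg fun ω => sq_nonneg _
    have h3 := hsq.sum_le_tsum (Finset.range N) fun i _ => sq_nonneg _
    linarith
  filter_upwards [ae_summable_of_summable_integral
    (F := fun (n : ℕ) ω => γ / ((n : ℝ) + 1) * w n ω) (fun n ω => mul_nonneg (by positivity) (hw0 n ω))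
    (fun n => (hwi n).const_mul _) hIsum]
    with ω hω
  refine tendsto_sq_zero_of_summable_div hγ (fun n => hw0 n ω) hω (fun n => ?_) hsq
  have h1 := hstep n ω
  have h2 : 0 ≤ γ / ((n : ℝ) + 1) * w n ω := mul_nonneg (by positivity) (hw0 n ω)
  split_ifs at h1
  · linarith
  · nlinarith [mul_nonneg hc.le h2]

/-- A nearest-point map onto a convex set does not increase distances to points of the set. -/
theorem norm_nearest_sub_le {E : Type*} [NormedAddCommGroup E] [InnerProductSpace ℝ E]
    {X : Set E} (hX : Convex ℝ X) {z u y : E} (hu : u ∈ X)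
    (hnear : ∀ v ∈ X, ‖u - z‖ ≤ ‖v - z‖) (hy : y ∈ X) : ‖u - y‖ ≤ ‖z - y‖ := by
  have hinf : ‖z - u‖ = ⨅ v : X, ‖z - v‖ := by
    have : Nonempty X := ⟨⟨u, hu⟩⟩
    refine le_antisymm (le_ciInf fun v => ?_) (ciInf_le ⟨0, ?_⟩ (⟨u, hu⟩ : X))
    · rw [norm_sub_rev z u, norm_sub_rev z v]
      exact hnear v v.2
    · rintro _ ⟨v, rfl⟩
      exact norm_nonneg _
  have hinner := (norm_eq_iInf_iff_real_inner_le_zero hX hu).1 hinf y hy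
  have hexp : ‖z - y‖ ^ 2 = ‖z - u‖ ^ 2 - 2 * ⟪z - u, y - u⟫_ℝ + ‖u - y‖ ^ 2 := by
    rw [norm_sub_rev u y, ← norm_sub_sq_real, sub_sub_sub_cancel_right]
  refine le_of_sq_le_sq ?_ (norm_nonneg _)
  nlinarith [sq_nonneg ‖z - u‖]

/-- Squared distance after a normalized step of length `s` in direction `-v`, with angle
coefficient `k`. -/
theorem norm_normalized_step_sub_sq_le {E : Type*} [NormedAddCommGroup E] [InnerProductSpace ℝ E]
    {u v y : E} {s k : ℝ} (hs : 0 ≤ s) (hv : v ≠ 0)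
    (hk : k * ‖v‖ * ‖u - y‖ ≤ ⟪v, u - y⟫_ℝ) :
    ‖u - (s * ‖v‖⁻¹) • v - y‖ ^ 2 ≤ ‖u - y‖ ^ 2 - 2 * s * (k * ‖u - y‖) + s ^ 2 := by
  have hv0 : 0 < ‖v‖ := norm_pos_iff.2 hv
  have hin : k * ‖u - y‖ ≤ ‖v‖⁻¹ * ⟪v, u - y⟫_ℝ := by
    rw [inv_mul_eq_div, le_div_iff₀ hv0]
    linarith
  have hn : ‖(s * ‖v‖⁻¹) • v‖ = s := by
    rw [norm_smul, Real.norm_of_nonneg (by positivity)]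
    field_simp
  rw [sub_right_comm, norm_sub_sq_real, hn, real_inner_smul_right, real_inner_comm]
  nlinarith [mul_le_mul_of_nonneg_left hin hs]

/-- **Theorem 2 (almost sure convergence), convex case.** Under the same assumptions as
the rate statement, the iterates of the normalized subgradient method under probabilistic
corruption converge almost surely to the set of minimizers:
`‖x_t - x⋆(x_t)‖² → 0` almost surely. -/
theorem nsm_convex_as_convergence
    {d : ℕ} {Ω : Type*} {mΩ : MeasurableSpace Ω}
    (μprob : Measure Ω) [IsProbabilityMeasure μprob]
    -- the constraint set: compact, convex, diameter at most `R`
    (X : Set (EuclideanSpace ℝ (Fin d))) (hXne : X.Nonempty)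
    (hXcompact : IsCompact X) (hXconv : Convex ℝ X)
    (R : ℝ) (hR : 0 < R)
    (hdiam : ∀ x₁ ∈ X, ∀ x₂ ∈ X, ‖x₁ - x₂‖ ≤ R)
    -- the objective: convex, with nonempty set `S` of minimizers over `X`
    (f : EuclideanSpace ℝ (Fin d) → ℝ) (hfconv : ConvexOn ℝ Set.univ f)
    (S : Set (EuclideanSpace ℝ (Fin d)))
    (hS : S = {y ∈ X | ∀ z ∈ X, f y ≤ f z}) (hSne : S.Nonempty)
    -- `xstar z` is the minimizer nearest to `z`
    (xstar : EuclideanSpace ℝ (Fin d) → EuclideanSpace ℝ (Fin d))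
    (hxstarS : ∀ z, xstar z ∈ S)
    (hxstar_near : ∀ z, ∀ y ∈ S, ‖z - xstar z‖ ≤ ‖z - y‖)
    (hxstar_meas : Measurable xstar)
    -- the acute angle condition with constant `cos φ`, `φ ∈ [0, π/2)`
    (φ : ℝ) (hφ0 : 0 ≤ φ) (hφ1 : φ < Real.pi / 2)
    (hacute : ∀ z ∈ X, ∀ v : EuclideanSpace ℝ (Fin d),
      (∀ y, f z + ⟪v, y - z⟫_ℝ ≤ f y) →
      Real.cos φ * ‖v‖ * ‖z - xstar z‖ ≤ ⟪v, z - xstar z⟫_ℝ)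
    -- corruption probability and step-size parameters
    (p q γ : ℝ) (hp0 : 0 ≤ p) (hpq : p ≤ q)
    (hq : q < Real.cos φ / (1 + Real.cos φ))
    (hγ : γ = R / (2 * ((1 - q) * Real.cos φ - q)))
    -- Euclidean projection onto `X`
    (proj : EuclideanSpace ℝ (Fin d) → EuclideanSpace ℝ (Fin d))
    (hprojX : ∀ z, proj z ∈ X)
    (hproj_near : ∀ z, ∀ y ∈ X, ‖proj z - z‖ ≤ ‖y - z‖)
    -- the iterates, feedback, corruptions and corruption indicators
    (x h b g : ℕ → Ω → EuclideanSpace ℝ (Fin d)) (Y : ℕ → Ω → Bool)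
    (hxmeas : ∀ t, Measurable (x t)) (hbmeas : ∀ t, Measurable (b t))
    (hgmeas : ∀ t, Measurable (g t)) (hYmeas : ∀ t, Measurable (Y t))
    (hx1 : ∀ ω, x 1 ω ∈ X)
    -- `g t` is a subgradient of `f` at `x t`
    (hgsub : ∀ t ω, ∀ y, f (x t ω) + ⟪g t ω, y - x t ω⟫_ℝ ≤ f y)
    -- the received feedback: corrupted with probability `p`
    (hfeed : ∀ t ω, h t ω = if Y t ω = true then b t ω else g t ω)
    (hYp : ∀ t, μprob {ω | Y t ω = true} = ENNReal.ofReal p)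
    (hYindep : ∀ t, IndepFun (Y t) (x t) μprob)
    -- the normalized subgradient update with step size `γ/t`
    (hupdate : ∀ t : ℕ, 1 ≤ t → ∀ ω,
      x (t + 1) ω =
        if h t ω ≠ 0 then
          proj (x t ω - ((γ / (t : ℝ)) * ‖h t ω‖⁻¹) • h t ω)
        else x t ω) :
    ∀ᵐ ω ∂μprob,
      Tendsto (fun t => ‖x t ω - xstar (x t ω)‖ ^ 2) atTop (𝓝 0) := by
  set c := Real.cos φ with hc_def
  have hc : 0 < c := Real.cos_pos_of_mem_Ioo ⟨by linarith [Real.pi_pos], hφ1⟩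
  have hq' : q * (1 + c) < c := (lt_div_iff₀ (by linarith)).1 hq
  have hγ0 : 0 < γ := by
    rw [hγ]
    exact div_pos hR (by linarith)
  have hpc : p < (1 - p) * c := by nlinarith
  have hSX : ∀ y ∈ S, y ∈ X := fun y hy => by
    rw [hS] at hy
    exact hy.1
  have hxX : ∀ (n : ℕ) ω, x (n + 1) ω ∈ X := by
    intro n ω
    induction n with
    | zero => exact hx1 ω
    | succ k ih =>
      rw [hupdate (k + 1) (by omega) ω]
      split_ifs
      · exact hprojX _
      · exact ih
  have hwm : ∀ n, Measurable fun ω => ‖x n ω - xstar (x n ω)‖ := fun n =>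
    ((hxmeas n).sub (hxstar_meas.comp (hxmeas n))).norm
  have hae := ae_tendsto_sq_zero_of_corrupted_drift (μ := μprob)
    (w := fun n ω => ‖x (n + 1) ω - xstar (x (n + 1) ω)‖) (Y := fun n => Y (n + 1))
    (R := R) hγ0 hc hp0 hpc (fun n ω => norm_nonneg _)
    (fun n ω => hdiam _ (hxX n ω) _ (hSX _ (hxstarS _)))
    (fun n => hwm _) (fun n => hYmeas _) (fun n => hYp _)
    (fun n => (hYindep (n + 1)).comp measurable_id
      (measurable_id.sub hxstar_meas).norm) ?_
  · filter_upwards [hae] with ω hω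
    exact (tendsto_add_atTop_iff_nat 1).1 hω
  intro n ω
  set u := x (n + 1) ω with hu
  set s := γ / ((n : ℝ) + 1) with hs_def
  have hs : 0 ≤ s := by positivity
  have hup := hupdate (n + 1) (by omega) ω
  have hfd := hfeed (n + 1) ω
  rw [← hu] at hup
  have hcast : γ / ((n + 1 : ℕ) : ℝ) = s := by rw [hs_def]; push_cast; rfl
  rw [hcast] at hup
  have hnear : ‖x (n + 1 + 1) ω - xstar (x (n + 1 + 1) ω)‖ ^ 2 ≤
      ‖x (n + 1 + 1) ω - xstar u‖ ^ 2 :=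
    pow_le_pow_left₀ (norm_nonneg _) (hxstar_near _ _ (hxstarS u)) 2
  refine hnear.trans ?_
  have hsub := hgsub (n + 1) ω
  rw [← hu] at hsub
  by_cases hh : h (n + 1) ω = 0
  · rw [if_neg (not_not.2 hh)] at hup
    rw [hup]
    split_ifs with hY
    · nlinarith [mul_nonneg hs (norm_nonneg (u - xstar u))]
    · rw [if_neg hY] at hfd
      have huS : u ∈ S := by
        rw [hS]
        refine ⟨hxX n ω, fun z _ => ?_⟩
        have := hsub z
        rwa [← hfd, hh, inner_zero_left, add_zero] at this
      have hzero : ‖u - xstar u‖ = 0 := by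
        refine le_antisymm ?_ (norm_nonneg _)
        simpa using hxstar_near u u huS
      rw [hzero]
      nlinarith [sq_nonneg s]
  · rw [if_pos hh] at hup
    have hproj := norm_nearest_sub_le hXconv (hprojX _) (hproj_near (u - (s * ‖h (n + 1) ω‖⁻¹) •
      h (n + 1) ω)) (hSX _ (hxstarS u))
    rw [← hup] at hproj
    refine (pow_le_pow_left₀ (norm_nonneg _) hproj 2).trans
      (norm_normalized_step_sub_sq_le hs hh ?_)
    split_ifs with hY
    · have := neg_le_of_abs_le (abs_real_inner_le_norm (h (n + 1) ω) (u - xstar u))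
      linarith
    · rw [if_neg hY] at hfd
      rw [hfd]
      exact hacute u (hxX n ω) _ hsub
end

section
/- Let $\mathcal{X} \subseteq \mathbb{R}^d$ be a compact convex set with diameter at most $R$ that contains a nonempty open ball centered at the unique minimizer $x^\star$ of $f$ over $\mathcal{X}$, and let $f : \mathbb{R}^d \to \mathbb{R}$ be differentiable, $\mu$-strongly convex, and $\beta$-smooth on $\mathcal{X}$, with condition number $\kappa = \beta/\mu$. Suppose the corruption probability satisfies $p < 1/(1+\kappa)$, fix $q \in [p, 1/(1+\kappa))$, set $\gamma = \kappa R / (2((1-q) - q\kappa))$ and step sizes $\gamma_t = \gamma/t$. Let $(x_t)_{t\ge 1}$ be the iterates of the normalized subgradient method under probabilistic corruption with these parameters, where each corruption indicator $Y_t$ is Bernoulli($p$) and independent of $x_t$. Then for every $T \ge 1$, $\mathbb{E}[\|x_{T+1} - x^\star\|^2] \le \gamma^2(1+\log T)/T$. -/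
open MeasureTheory ProbabilityTheory Filter Topology Classical
open scoped InnerProductSpace

section Helpers

variable {E : Type*} [NormedAddCommGroup E] [InnerProductSpace ℝ E]

/-- A nearest point of a convex set is at least as close to any point of the set as the
original point is. -/
theorem norm_sub_le_of_nearest {X : Set E} (hX : Convex ℝ X) {z w y : E} (hw : w ∈ X)
    (hnear : ∀ v ∈ X, ‖w - z‖ ≤ ‖v - z‖) (hy : y ∈ X) : ‖w - y‖ ≤ ‖z - y‖ := by
  have hinf : ‖z - w‖ = ⨅ v : X, ‖z - v‖ := by
    have : Nonempty X := ⟨⟨w, hw⟩⟩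
    refine le_antisymm (le_ciInf fun v => ?_) (ciInf_le ⟨0, ?_⟩ (⟨w, hw⟩ : X))
    · simpa [norm_sub_rev] using hnear v v.2
    · rintro _ ⟨v, rfl⟩
      exact norm_nonneg _
  have hin := (norm_eq_iInf_iff_real_inner_le_zero hX hw).1 hinf y hy
  have hexp : ‖z - y‖ ^ 2 = ‖z - w‖ ^ 2 - 2 * ⟪z - w, y - w⟫_ℝ + ‖w - y‖ ^ 2 := by
    rw [norm_sub_rev w y, ← norm_sub_sq_real]
    congr 2
    abel
  refine le_of_sq_le_sq ?_ (norm_nonneg _)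
  nlinarith [sq_nonneg ‖z - w‖]

/-- Expansion of the squared distance after a step of length `a` in a normalized direction. -/
theorem norm_normalized_step_sub_sq {x y v : E} (hv : v ≠ 0) (a : ℝ) :
    ‖x - (a * ‖v‖⁻¹) • v - y‖ ^ 2
      = ‖x - y‖ ^ 2 - 2 * a * (‖v‖⁻¹ * ⟪v, x - y⟫_ℝ) + a ^ 2 := by
  have hn : ‖v‖ ≠ 0 := norm_ne_zero_iff.2 hv
  rw [show x - (a * ‖v‖⁻¹) • v - y = (x - y) - (a * ‖v‖⁻¹) • v by abel, norm_sub_sq_real,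
    inner_smul_right, norm_smul, mul_pow, real_inner_comm, Real.norm_eq_abs, sq_abs]
  field_simp

/-- If `⟪g, u⟫ ≥ μ ‖u‖²` and `‖g‖ ≤ β ‖u‖`, then the normalized `g` has correlation at least
`(μ / β) ‖u‖` with `u`. -/
theorem div_mul_norm_le_normalized_inner {g u : E} {μ β : ℝ} (hμ : 0 < μ) (hβ : 0 < β)
    (hg : g ≠ 0) (hlow : μ * ‖u‖ ^ 2 ≤ ⟪g, u⟫_ℝ) (hup : ‖g‖ ≤ β * ‖u‖) :
    μ / β * ‖u‖ ≤ ‖g‖⁻¹ * ⟪g, u⟫_ℝ := by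
  have hn : 0 < ‖g‖ := norm_pos_iff.2 hg
  rw [← div_eq_inv_mul, le_div_iff₀ hn]
  calc μ / β * ‖u‖ * ‖g‖ ≤ μ / β * ‖u‖ * (β * ‖u‖) := by gcongr
    _ = μ * ‖u‖ ^ 2 := by field_simp
    _ ≤ _ := hlow

end Helpers

/-- The recursion `e_{t+1} ≤ (1 - 1/t) e_t + C/t²` yields a `(1 + log T)/T` rate. -/
theorem le_log_div_of_recursion {e : ℕ → ℝ} {C : ℝ} (hC : 0 ≤ C)
    (hrec : ∀ t : ℕ, 1 ≤ t → e (t + 1) ≤ (1 - 1 / (t : ℝ)) * e t + C / (t : ℝ) ^ 2)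
    {T : ℕ} (hT : 1 ≤ T) : e (T + 1) ≤ C * (1 + Real.log T) / T := by
  have hsum : ∀ n : ℕ, (n : ℝ) * e (n + 1) ≤ C * (harmonic n : ℝ) := by
    intro n
    induction n with
    | zero => simp
    | succ n ih =>
      have hn : (0 : ℝ) < (n : ℝ) + 1 := by positivity
      have h := mul_le_mul_of_nonneg_left (hrec (n + 1) (by omega)) hn.le
      push_cast [harmonic_succ] at h ⊢
      have heq : ((n : ℝ) + 1) * ((1 - 1 / ((n : ℝ) + 1)) * e (n + 1) + C / ((n : ℝ) + 1) ^ 2)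
          = n * e (n + 1) + C * ((n : ℝ) + 1)⁻¹ := by
        field_simp
        ring
      linarith
  have hT0 : (0 : ℝ) < T := by exact_mod_cast hT
  rw [le_div_iff₀ hT0, mul_comm]
  exact (hsum T).trans (mul_le_mul_of_nonneg_left (harmonic_le_one_add_log T) hC)

/-- **Corollary 1 (rate), strongly convex case.** For a `μ`-strongly convex and
`β`-smooth function with condition number `κ = β/μ`, on a compact convex set of diameter
at most `R` containing a ball around the unique minimizer `x⋆`, if the corruption
probability `p` is below `1/(1+κ)`, the normalized subgradient method with step sizes
`γ_t = γ/t`, `γ = κR/(2((1-q) - qκ))`, satisfies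
`E[‖x_{T+1} - x⋆‖²] ≤ γ² (1 + log T)/T`. -/
theorem nsm_strongly_convex_rate
    {d : ℕ} {Ω : Type*} {mΩ : MeasurableSpace Ω}
    (μprob : Measure Ω) [IsProbabilityMeasure μprob]
    -- the constraint set: compact, convex, diameter at most `R`
    (X : Set (EuclideanSpace ℝ (Fin d))) (hXne : X.Nonempty)
    (hXcompact : IsCompact X) (hXconv : Convex ℝ X)
    (R : ℝ) (hR : 0 < R)
    (hdiam : ∀ x₁ ∈ X, ∀ x₂ ∈ X, ‖x₁ - x₂‖ ≤ R)
    -- the objective: differentiable, `μ`-strongly convex and `β`-smooth on `X`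
    (f : EuclideanSpace ℝ (Fin d) → ℝ)
    (hdiff : ∀ z ∈ X, DifferentiableAt ℝ f z)
    (μ β κ : ℝ) (hμ : 0 < μ) (hβ : 0 < β) (hκ : κ = β / μ)
    (hsmooth : ∀ x₁ ∈ X, ∀ x₂ ∈ X,
      ‖gradient f x₁ - gradient f x₂‖ ≤ β * ‖x₁ - x₂‖)
    (hstrong : ∀ x₁ ∈ X, ∀ x₂ ∈ X,
      μ * ‖x₁ - x₂‖ ^ 2 ≤ ⟪gradient f x₁ - gradient f x₂, x₁ - x₂⟫_ℝ)
    -- `xs` is the unique minimizer of `f` over `X`, and `X` contains a ball around it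
    (xs : EuclideanSpace ℝ (Fin d)) (hxsX : xs ∈ X)
    (hxsmin : ∀ y ∈ X, f xs ≤ f y)
    (hxsuniq : ∀ y ∈ X, (∀ z ∈ X, f y ≤ f z) → y = xs)
    (hball : ∃ ε > 0, Metric.ball xs ε ⊆ X)
    -- corruption probability and step-size parameters
    (p q γ : ℝ) (hp0 : 0 ≤ p) (hpq : p ≤ q)
    (hq : q < 1 / (1 + κ))
    (hγ : γ = κ * R / (2 * ((1 - q) - q * κ)))
    -- Euclidean projection onto `X`
    (proj : EuclideanSpace ℝ (Fin d) → EuclideanSpace ℝ (Fin d))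
    (hprojX : ∀ z, proj z ∈ X)
    (hproj_near : ∀ z, ∀ y ∈ X, ‖proj z - z‖ ≤ ‖y - z‖)
    -- the iterates, feedback, corruptions and corruption indicators
    (x h b : ℕ → Ω → EuclideanSpace ℝ (Fin d)) (Y : ℕ → Ω → Bool)
    (hxmeas : ∀ t, Measurable (x t)) (hbmeas : ∀ t, Measurable (b t))
    (hYmeas : ∀ t, Measurable (Y t))
    (hx1 : ∀ ω, x 1 ω ∈ X)
    -- the received feedback: corrupted with probability `p`
    (hfeed : ∀ t ω, h t ω = if Y t ω = true then b t ω else gradient f (x t ω))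
    (hYp : ∀ t, μprob {ω | Y t ω = true} = ENNReal.ofReal p)
    (hYindep : ∀ t, IndepFun (Y t) (x t) μprob)
    -- the normalized subgradient update with step size `γ/t`
    (hupdate : ∀ t : ℕ, 1 ≤ t → ∀ ω,
      x (t + 1) ω =
        if h t ω ≠ 0 then
          proj (x t ω - ((γ / (t : ℝ)) * ‖h t ω‖⁻¹) • h t ω)
        else x t ω) :
    ∀ T : ℕ, 1 ≤ T →
      ∫ ω, ‖x (T + 1) ω - xs‖ ^ 2 ∂μprob ≤
        γ ^ 2 * (1 + Real.log T) / T := by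
  have hxX : ∀ t : ℕ, 1 ≤ t → ∀ ω, x t ω ∈ X := by
    intro t ht
    induction t, ht using Nat.le_induction with
    | base => exact hx1
    | succ t ht ih =>
      intro ω
      rw [hupdate t ht ω]
      split_ifs
      exacts [hprojX _, ih ω]
  have hgrad : gradient f xs = 0 := by
    obtain ⟨ε, hε, hsub⟩ := hball
    have hmin : IsLocalMin f xs :=
      Filter.eventually_of_mem (Metric.ball_mem_nhds xs hε) fun y hy => hxsmin y (hsub hy)
    simp [gradient, hmin.fderiv_eq_zero]
  have hκ0 : 0 < κ := hκ ▸ div_pos hβ hμ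
  have hκinv : μ / β = κ⁻¹ := by rw [hκ, inv_div]
  have hq' : 0 < (1 - q) - q * κ := by
    rw [lt_div_iff₀ (by positivity)] at hq
    linarith
  have hγ0 : 0 < γ := by rw [hγ]; positivity
  have hstep : ∀ t : ℕ, 1 ≤ t → ∀ ω, ‖x (t + 1) ω - xs‖ ^ 2 ≤
      ‖x t ω - xs‖ ^ 2 + (γ / t) ^ 2 - 2 * (γ / t) * κ⁻¹ * ‖x t ω - xs‖
        + 2 * (γ / t) * (1 + κ⁻¹) *
          ({ω | Y t ω = true}.indicator 1 ω * ‖x t ω - xs‖) := by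
    intro t ht ω
    have hs : 0 ≤ γ / (t : ℝ) := by positivity
    have hproj : h t ω ≠ 0 → ‖x (t + 1) ω - xs‖ ^ 2 ≤ ‖x t ω - xs‖ ^ 2
        - 2 * (γ / t) * (‖h t ω‖⁻¹ * ⟪h t ω, x t ω - xs⟫_ℝ) + (γ / t) ^ 2 := by
      intro hne
      rw [hupdate t ht ω, if_pos hne, ← norm_normalized_step_sub_sq hne]
      gcongr
      exact norm_sub_le_of_nearest hXconv (hprojX _) (hproj_near _) hxsX
    have hr := norm_nonneg (x t ω - xs)
    by_cases hY : Y t ω = true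
    · have hind : {ω | Y t ω = true}.indicator (1 : Ω → ℝ) ω = 1 := by simp [hY]
      rw [hind]
      by_cases hne : h t ω = 0
      · rw [hupdate t ht ω, if_neg (by simpa using hne)]
        nlinarith [mul_nonneg hs hr, sq_nonneg (γ / (t : ℝ))]
      · have hin : -‖x t ω - xs‖ ≤ ‖h t ω‖⁻¹ * ⟪h t ω, x t ω - xs⟫_ℝ := by
          rw [← div_eq_inv_mul, le_div_iff₀ (norm_pos_iff.2 hne)]
          have := neg_le_of_abs_le (abs_real_inner_le_norm (h t ω) (x t ω - xs))
          linarith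
        nlinarith [hproj hne, mul_le_mul_of_nonneg_left hin hs]
    · have hind : {ω | Y t ω = true}.indicator (1 : Ω → ℝ) ω = 0 := by simp [hY]
      have hg : h t ω = gradient f (x t ω) := by rw [hfeed, if_neg hY]
      have hlow := hstrong _ (hxX t ht ω) _ hxsX
      have hup := hsmooth _ (hxX t ht ω) _ hxsX
      rw [hgrad, sub_zero, ← hg] at hlow hup
      rw [hind]
      by_cases hne : h t ω = 0
      · have h0 : ‖x t ω - xs‖ = 0 := by
          rw [hne, inner_zero_left] at hlow
          have : ‖x t ω - xs‖ ^ 2 ≤ 0 := by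
            by_contra! hpos
            exact absurd hlow (not_le.2 (mul_pos hμ hpos))
          nlinarith
        rw [hupdate t ht ω, if_neg (by simpa using hne), h0]
        nlinarith [sq_nonneg (γ / (t : ℝ))]
      · have hin := div_mul_norm_le_normalized_inner hμ hβ hne hlow hup
        rw [hκinv] at hin
        nlinarith [hproj hne, mul_le_mul_of_nonneg_left hin hs]
  have hrmeas : ∀ t, Measurable fun ω => ‖x t ω - xs‖ := fun t =>
    ((hxmeas t).sub_const xs).norm
  have hrle : ∀ t : ℕ, 1 ≤ t → ∀ ω, ‖x t ω - xs‖ ≤ R := fun t ht ω =>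
    hdiam _ (hxX t ht ω) _ hxsX
  have hint1 : ∀ t : ℕ, 1 ≤ t → Integrable (fun ω => ‖x t ω - xs‖) μprob := fun t ht =>
    .of_bound (hrmeas t).aestronglyMeasurable R
      (.of_forall fun ω => by simpa using hrle t ht ω)
  have hint2 : ∀ t : ℕ, 1 ≤ t → Integrable (fun ω => ‖x t ω - xs‖ ^ 2) μprob := fun t ht =>
    .of_bound ((hrmeas t).pow_const 2).aestronglyMeasurable (R ^ 2)
      (.of_forall fun ω => by
        rw [Real.norm_of_nonneg (by positivity)]
        have := hrle t ht ω
        gcongr)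
  have hYset : ∀ t, MeasurableSet {ω | Y t ω = true} := fun t =>
    hYmeas t (measurableSet_singleton true)
  have hint3 : ∀ t : ℕ, 1 ≤ t → Integrable (fun ω =>
      {ω | Y t ω = true}.indicator (1 : Ω → ℝ) ω * ‖x t ω - xs‖) μprob := by
    intro t ht
    refine ((hint1 t ht).indicator (hYset t)).congr (.of_forall fun ω => ?_)
    by_cases hY : Y t ω = true <;> simp [hY]
  have hprod : ∀ t : ℕ, ∫ ω, {ω | Y t ω = true}.indicator (1 : Ω → ℝ) ω * ‖x t ω - xs‖ ∂μprob
      = p * ∫ ω, ‖x t ω - xs‖ ∂μprob := by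
    intro t
    have hi : IndepFun ({ω | Y t ω = true}.indicator (1 : Ω → ℝ))
        (fun ω => ‖x t ω - xs‖) μprob := by
      convert (hYindep t).comp (φ := fun c : Bool => if c = true then (1 : ℝ) else 0)
        (ψ := fun v => ‖v - xs‖) (measurable_of_finite _) (by fun_prop) using 1
      · ext ω
        simp [Set.indicator_apply]
      · rfl
    have hm : Measurable ({ω | Y t ω = true}.indicator (1 : Ω → ℝ)) :=
      measurable_one.indicator (hYset t)
    rw [hi.integral_fun_mul_eq_mul_integral hm.aestronglyMeasurable
      (hrmeas t).aestronglyMeasurable, integral_indicator_one (hYset t), measureReal_def,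
      hYp t, ENNReal.toReal_ofReal hp0]
  intro T hT
  refine le_log_div_of_recursion (e := fun t => ∫ ω, ‖x t ω - xs‖ ^ 2 ∂μprob)
    (sq_nonneg γ) (fun t ht => ?_) hT
  have ht0 : (0 : ℝ) < t := by exact_mod_cast ht
  have hs : 0 < γ / (t : ℝ) := by positivity
  have hE : ∫ ω, ‖x (t + 1) ω - xs‖ ^ 2 ∂μprob ≤ (∫ ω, ‖x t ω - xs‖ ^ 2 ∂μprob) + (γ / t) ^ 2
      - 2 * (γ / t) * κ⁻¹ * (∫ ω, ‖x t ω - xs‖ ∂μprob)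
      + 2 * (γ / t) * (1 + κ⁻¹) * (p * ∫ ω, ‖x t ω - xs‖ ∂μprob) := by
    have hA := (hint2 t ht).add (integrable_const (μ := μprob) ((γ / (t : ℝ)) ^ 2))
    have hB := (hint1 t ht).const_mul (2 * (γ / t) * κ⁻¹)
    have hD := (hint3 t ht).const_mul (2 * (γ / t) * (1 + κ⁻¹))
    refine (integral_mono (hint2 (t + 1) (by omega)) ((hA.sub hB).add hD)
      (hstep t ht)).trans_eq ?_
    rw [integral_add' (hA.sub hB) hD, integral_sub' hA hB,
      integral_add' (hint2 t ht) (integrable_const _), integral_const_mul, integral_const_mul,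
      hprod t]
    simp
  have hRle : (∫ ω, ‖x t ω - xs‖ ^ 2 ∂μprob) ≤ R * ∫ ω, ‖x t ω - xs‖ ∂μprob := by
    rw [← integral_const_mul]
    refine integral_mono (hint2 t ht) ((hint1 t ht).const_mul R) fun ω => ?_
    have := mul_le_mul_of_nonneg_right (hrle t ht ω) (norm_nonneg (x t ω - xs))
    simpa [sq] using this
  have hm0 : 0 ≤ ∫ ω, ‖x t ω - xs‖ ∂μprob := integral_nonneg fun ω => norm_nonneg _
  set m := ∫ ω, ‖x t ω - xs‖ ∂μprob
  set e := ∫ ω, ‖x t ω - xs‖ ^ 2 ∂μprob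
  have hcoef : R / (2 * γ) ≤ κ⁻¹ - (1 + κ⁻¹) * p := by
    have h1 : R / (2 * γ) = κ⁻¹ - (1 + κ⁻¹) * q := by
      rw [hγ]
      field_simp
      ring
    rw [h1]
    gcongr
  have hdrift : 1 / (t : ℝ) * e ≤ 2 * (γ / t) * ((κ⁻¹ - (1 + κ⁻¹) * p) * m) :=
    calc 1 / (t : ℝ) * e ≤ 1 / (t : ℝ) * (R * m) := by gcongr
      _ = 2 * (γ / t) * (R / (2 * γ) * m) := by field_simp
      _ ≤ _ := by gcongr
  have hsq : (γ / (t : ℝ)) ^ 2 = γ ^ 2 / (t : ℝ) ^ 2 := div_pow _ _ _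
  change ∫ ω, ‖x (t + 1) ω - xs‖ ^ 2 ∂μprob ≤ (1 - 1 / (t : ℝ)) * e + γ ^ 2 / (t : ℝ) ^ 2
  rw [← hsq]
  linarith
end

section
/- Let $\mathcal{X} \subseteq \mathbb{R}^d$ be a compact convex set with diameter at most $R$, and let $f : \mathbb{R}^d \to \mathbb{R}$ be a differentiable weakly pseudo-convex function whose set of minimizers over $\mathcal{X}$ is nonempty and which satisfies the acute angle condition on $\mathcal{X}$ with constant $\cos\phi > 0$ for some $\phi \in [0,\pi/2)$. Suppose the corruption probability satisfies $p < \cos\phi/(1+\cos\phi)$, fix $q \in [p, \cos\phi/(1+\cos\phi))$, set $\gamma = R/(2((1-q)\cos\phi - q))$ and step sizes $\gamma_t = \gamma/t$. Let $(x_t)_{t\ge 1}$ be the iterates of the normalized subgradient method under probabilistic corruption with these parameters, where each corruption indicator $Y_t$ is Bernoulli($p$) and independent of $x_t$. Then for every $T \ge 1$, $\mathbb{E}[\|x_{T+1} - x^\star(x_{T+1})\|^2] \le \gamma^2(1+\log T)/T$, and $\lim_{t\to\infty} \|x_t - x^\star(x_t)\|^2 = 0$ almost surely. -/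
open MeasureTheory ProbabilityTheory Filter Topology Classical
open scoped InnerProductSpace

/-- The metric projection onto a convex set does not increase distances to points of the set. -/
lemma norm_proj_sub_le_of_mem {E : Type*} [NormedAddCommGroup E] [InnerProductSpace ℝ E]
    {X : Set E} (hX : Convex ℝ X) {z w y : E} (hw : w ∈ X)
    (hnear : ∀ v ∈ X, ‖w - z‖ ≤ ‖v - z‖) (hy : y ∈ X) : ‖w - y‖ ≤ ‖z - y‖ := by
  have hmin : ‖z - w‖ = ⨅ v : X, ‖z - v‖ := by
    have : Nonempty X := ⟨⟨w, hw⟩⟩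
    refine le_antisymm (le_ciInf fun v => ?_) (ciInf_le ⟨0, ?_⟩ (⟨w, hw⟩ : X))
    · rw [norm_sub_rev z w, norm_sub_rev z]
      exact hnear v v.2
    · rintro _ ⟨v, rfl⟩
      exact norm_nonneg _
  have hinner := (norm_eq_iInf_iff_real_inner_le_zero hX hw).1 hmin y hy
  have hexp : ‖z - y‖ ^ 2 = ‖z - w‖ ^ 2 - 2 * ⟪z - w, y - w⟫_ℝ + ‖w - y‖ ^ 2 := by
    rw [norm_sub_rev w y, ← norm_sub_sq_real, sub_sub_sub_cancel_right]
  refine le_of_sq_le_sq ?_ (norm_nonneg _)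
  nlinarith [sq_nonneg ‖z - w‖]

/-- Normalizing a vector gives a vector of norm at most one. -/
lemma norm_inv_norm_smul_le_one {E : Type*} [NormedAddCommGroup E] [NormedSpace ℝ E] (v : E) :
    ‖‖v‖⁻¹ • v‖ ≤ 1 := by
  rw [norm_smul, norm_inv, norm_norm]
  exact inv_mul_le_one

/-- The distance to a nearest point of a fixed set is `1`-Lipschitz. -/
lemma abs_norm_sub_nearest_sub_le {E : Type*} [NormedAddCommGroup E] {S : Set E} {n : E → E}
    (hnS : ∀ z, n z ∈ S) (hn : ∀ z, ∀ y ∈ S, ‖z - n z‖ ≤ ‖z - y‖) (a b : E) :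
    |‖a - n a‖ - ‖b - n b‖| ≤ ‖a - b‖ := by
  have key : ∀ a b : E, ‖a - n a‖ ≤ ‖a - b‖ + ‖b - n b‖ := fun a b =>
    (hn a _ (hnS b)).trans (norm_sub_le_norm_sub_add_norm_sub a b (n b))
  have h := key b a
  rw [norm_sub_rev b a] at h
  exact abs_sub_le_iff.2 ⟨by linarith [key a b], by linarith⟩

/-- A nonnegative step along a direction of norm at most one, expanded around `y`. -/
lemma norm_sub_smul_sub_sq_le {E : Type*} [NormedAddCommGroup E] [InnerProductSpace ℝ E]
    {x g y : E} {s c : ℝ} (hs : 0 ≤ s) (hg : ‖g‖ ≤ 1) (hc : c * ‖x - y‖ ≤ ⟪g, x - y⟫_ℝ) :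
    ‖x - s • g - y‖ ^ 2 ≤ ‖x - y‖ ^ 2 - 2 * s * (c * ‖x - y‖) + s ^ 2 := by
  have hexp : ‖x - s • g - y‖ ^ 2 = ‖x - y‖ ^ 2 - 2 * (s * ⟪g, x - y⟫_ℝ) + s ^ 2 * ‖g‖ ^ 2 := by
    rw [sub_right_comm, norm_sub_sq_real, real_inner_smul_right, real_inner_comm, norm_smul,
      mul_pow, Real.norm_eq_abs, sq_abs]
  have hg2 : ‖g‖ ^ 2 ≤ 1 := pow_le_one₀ (norm_nonneg _) hg
  rw [hexp]
  nlinarith [mul_le_mul_of_nonneg_left hc hs, mul_le_mul_of_nonneg_left hg2 (sq_nonneg s)]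

/-- The recursion `a (t + 1) ≤ (1 - 1 / t) a t + C / t ^ 2` forces a rate `log T / T`. -/
lemma le_one_add_log_div_of_recursion {a : ℕ → ℝ} {C : ℝ} (hC : 0 ≤ C)
    (h : ∀ t : ℕ, 1 ≤ t → a (t + 1) ≤ (1 - 1 / (t : ℝ)) * a t + C / (t : ℝ) ^ 2)
    {T : ℕ} (hT : 1 ≤ T) : a (T + 1) ≤ C * (1 + Real.log T) / T := by
  have key : ∀ n : ℕ, n * a (n + 1) ≤ C * (harmonic n : ℝ) := by
    intro n
    induction n with
    | zero => simp
    | succ n ih =>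
      have hpos : (0 : ℝ) < n + 1 := by positivity
      have h1 := mul_le_mul_of_nonneg_left (h (n + 1) (by omega)) hpos.le
      push_cast [harmonic_succ] at h1 ⊢
      have h2 : ((n : ℝ) + 1) * ((1 - 1 / (n + 1)) * a (n + 1) + C / (n + 1) ^ 2)
          = n * a (n + 1) + C * (n + 1 : ℝ)⁻¹ := by
        field_simp
        ring
      linarith
  have hTpos : (0 : ℝ) < T := by exact_mod_cast hT
  rw [le_div_iff₀ hTpos, mul_comm]
  exact (key T).trans (mul_le_mul_of_nonneg_left (harmonic_le_one_add_log T) hC)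

/-- A sequence whose increments are `O(1 / n)` converges to zero as soon as it does so along
the squares. -/
lemma tendsto_zero_of_tendsto_sq_of_increments {v : ℕ → ℝ} {c : ℝ} (hv : ∀ n, 0 ≤ v n)
    (hc : 0 ≤ c) (hinc : ∀ n : ℕ, |v (n + 1) - v n| ≤ c / (n + 1))
    (hsq : Tendsto (fun k : ℕ => v (k ^ 2)) atTop (𝓝 0)) : Tendsto v atTop (𝓝 0) := by
  have hbound : ∀ k j : ℕ, v (k ^ 2 + j) ≤ v (k ^ 2) + j * (c / (k ^ 2 + 1)) := by
    intro k j
    induction j with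
    | zero => simp
    | succ j ih =>
      have h1 := (abs_le.1 (hinc (k ^ 2 + j))).2
      have h2 : c / (((k ^ 2 + j : ℕ) : ℝ) + 1) ≤ c / (k ^ 2 + 1) := by
        push_cast
        gcongr
        linarith [Nat.cast_nonneg (α := ℝ) j]
      rw [← add_assoc]
      push_cast
      linarith
  have hsqrt : Tendsto Nat.sqrt atTop atTop :=
    tendsto_atTop.2 fun b => (eventually_ge_atTop (b * b)).mono fun n hn => Nat.le_sqrt.2 hn
  have hlim : Tendsto (fun k : ℕ => v (k ^ 2) + 2 * c * (1 / ((k : ℝ) + 1)) * 2)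
      atTop (𝓝 0) := by
    simpa using hsq.add ((tendsto_one_div_add_atTop_nhds_zero_nat.const_mul (2 * c)).mul_const 2)
  refine squeeze_zero hv (fun n => ?_) (hlim.comp hsqrt)
  obtain ⟨j, hj⟩ := Nat.exists_eq_add_of_le (Nat.sqrt_le' n)
  have hj2 : j ≤ 2 * n.sqrt := by nlinarith [Nat.sqrt_le_add n]
  have h1 := hbound n.sqrt j
  rw [← hj] at h1
  refine h1.trans ?_
  simp only [Function.comp_apply]
  generalize n.sqrt = k at hj2
  have hj3 : (j : ℝ) ≤ 2 * k := by exact_mod_cast hj2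
  have h2 : (j : ℝ) * (c / (k ^ 2 + 1)) ≤ 2 * k * (c / (k ^ 2 + 1)) := by gcongr
  have h3 : 2 * (k : ℝ) * (c / (k ^ 2 + 1)) ≤ 2 * c * (1 / ((k : ℝ) + 1)) * 2 := by
    rw [← mul_div_assoc, mul_one_div, div_mul_eq_mul_div, div_le_div_iff₀ (by positivity)
      (by positivity)]
    have : 0 ≤ c * ((k - 1 / 2 : ℝ) ^ 2 + 1) := by positivity
    nlinarith
  linarith

lemma summable_one_add_log_sq_div_sq :
    Summable fun k : ℕ => (1 + Real.log ((k : ℝ) ^ 2)) / (k : ℝ) ^ 2 := by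
  have hs : Summable fun k : ℕ => 5 * (1 / (k : ℝ) ^ (3 / 2 : ℝ)) :=
    (Real.summable_one_div_nat_rpow.2 (by norm_num)).mul_left 5
  refine Summable.of_nonneg_of_le (fun k => ?_) (fun k => ?_) hs
  · have : 0 ≤ Real.log ((k : ℝ) ^ 2) := by exact_mod_cast Real.log_natCast_nonneg (k ^ 2)
    positivity
  · rcases Nat.eq_zero_or_pos k with rfl | hk
    · simp
    have hk1 : (1 : ℝ) ≤ k := by exact_mod_cast hk
    have hk0 : (0 : ℝ) < k := by linarith
    have h1 : Real.log k ≤ (k : ℝ) ^ (1 / 2 : ℝ) / (1 / 2) :=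
      Real.log_le_rpow_div hk0.le (by norm_num)
    have h2 : (1 : ℝ) ≤ (k : ℝ) ^ (1 / 2 : ℝ) := Real.one_le_rpow hk1 (by norm_num)
    have h3 : (k : ℝ) ^ 2 = (k : ℝ) ^ (1 / 2 : ℝ) * (k : ℝ) ^ (3 / 2 : ℝ) := by
      rw [← Real.rpow_add hk0]
      norm_num
    have h4 : (0 : ℝ) < (k : ℝ) ^ (3 / 2 : ℝ) := by positivity
    rw [Real.log_pow, h3, mul_one_div, div_le_div_iff₀ (by positivity) h4]
    have h5 : 1 + (2 : ℕ) * Real.log k ≤ 5 * (k : ℝ) ^ (1 / 2 : ℝ) := by push_cast; linarith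
    nlinarith [mul_le_mul_of_nonneg_right h5 h4.le]

/-- Nonnegative random variables whose expectations are summable converge to zero almost
surely. -/
lemma ae_tendsto_zero_of_summable_integral {Ω : Type*} {mΩ : MeasurableSpace Ω}
    {μ : Measure Ω} {w : ℕ → Ω → ℝ} (hw0 : ∀ k ω, 0 ≤ w k ω)
    (hw : ∀ k, Integrable (w k) μ) (hsum : Summable fun k => ∫ ω, w k ω ∂μ) :
    ∀ᵐ ω ∂μ, Tendsto (fun k => w k ω) atTop (𝓝 0) := by
  have hmeas : ∀ k, AEMeasurable (fun ω => ENNReal.ofReal (w k ω)) μ := fun k =>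
    (hw k).aemeasurable.ennreal_ofReal
  have hfin : ∫⁻ ω, ∑' k, ENNReal.ofReal (w k ω) ∂μ ≠ ⊤ := by
    rw [lintegral_tsum hmeas]
    simp_rw [← ofReal_integral_eq_lintegral_ofReal (hw _) (ae_of_all _ (hw0 _))]
    rw [← ENNReal.ofReal_tsum_of_nonneg (fun k => integral_nonneg (hw0 k)) hsum]
    exact ENNReal.ofReal_ne_top
  filter_upwards [ae_lt_top' (AEMeasurable.tsum hmeas) hfin] with ω hω
  have h := (ENNReal.tendsto_toReal ENNReal.zero_ne_top).comp
    (ENNReal.tendsto_atTop_zero_of_tsum_ne_top hω.ne)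
  simpa [Function.comp_def, ENNReal.toReal_ofReal (hw0 _ _)] using h

/-- A random sequence with increments `O(1 / n)` whose second moments are `O(log n / n)`
converges to zero almost surely; no independence is required. -/
lemma ae_tendsto_zero_of_increments_of_integral_sq_le {Ω : Type*} {mΩ : MeasurableSpace Ω}
    {μ : Measure Ω} {v : ℕ → Ω → ℝ} {c C : ℝ} (hv : ∀ n ω, 0 ≤ v n ω) (hc : 0 ≤ c)
    (hint : ∀ n, Integrable (fun ω => v n ω ^ 2) μ)
    (hinc : ∀ (n : ℕ) ω, |v (n + 1) ω - v n ω| ≤ c / (n + 1))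
    (hC : ∀ n : ℕ, 1 ≤ n → ∫ ω, v n ω ^ 2 ∂μ ≤ C * (1 + Real.log n) / n) :
    ∀ᵐ ω ∂μ, Tendsto (fun n => v n ω) atTop (𝓝 0) := by
  have hsum : Summable fun k : ℕ => ∫ ω, v (k ^ 2) ω ^ 2 ∂μ := by
    rw [← summable_nat_add_iff 1]
    refine Summable.of_nonneg_of_le (fun k => integral_nonneg fun ω => sq_nonneg _)
      (fun k => (hC _ (Nat.one_le_pow _ _ k.succ_pos)).trans_eq ?_)
      ((summable_nat_add_iff 1).2 (summable_one_add_log_sq_div_sq.mul_left C))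
    push_cast
    ring
  filter_upwards [ae_tendsto_zero_of_summable_integral (fun k ω => sq_nonneg (v (k ^ 2) ω))
    (fun k => hint _) hsum] with ω hω
  refine tendsto_zero_of_tendsto_sq_of_increments (hv · ω) hc (hinc · ω) ?_
  have h := (Real.continuous_sqrt.tendsto 0).comp hω
  simpa [Function.comp_def, Real.sqrt_sq (hv _ _)] using h

/-- Expectation of a quantity discounted by an independent Bernoulli indicator. -/
lemma integral_bernoulli_mul {Ω : Type*} {mΩ : MeasurableSpace Ω} {μ : Measure Ω}
    [IsProbabilityMeasure μ] {B : Ω → Bool} {u : Ω → ℝ} (hB : Measurable B) (hu : Measurable u)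
    (hind : IndepFun B u μ) {p : ℝ} (hp : 0 ≤ p)
    (hBp : μ {ω | B ω = true} = ENNReal.ofReal p) (r s : ℝ) :
    ∫ ω, (if B ω = true then r else s) * u ω ∂μ = (p * r + (1 - p) * s) * ∫ ω, u ω ∂μ := by
  have hg : Measurable fun β : Bool => if β = true then r else s := measurable_from_top
  have hset : MeasurableSet {ω | B ω = true} := hB (measurableSet_singleton true)
  have hE : ∫ ω, (if B ω = true then r else s) ∂μ = p * r + (1 - p) * s := by
    have hsplit : (fun ω => if B ω = true then r else s)
        = fun ω => {ω | B ω = true}.indicator (fun _ => r - s) ω + s := by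
      funext ω
      by_cases h : B ω = true <;> simp [Set.indicator, h]
    rw [hsplit, integral_add ((integrable_const _).indicator hset) (integrable_const _),
      integral_indicator_const _ hset, measureReal_def, hBp, ENNReal.toReal_ofReal hp]
    simp
    ring
  rw [← hE]
  exact (hind.comp hg measurable_id).integral_fun_mul_eq_mul_integral
    (hg.comp hB).aestronglyMeasurable hu.aestronglyMeasurable

/-- **Corollary 2, weakly pseudo-convex case.** For a differentiable weakly
pseudo-convex function satisfying the acute angle condition with constant `cos φ` on a
compact convex set of diameter at most `R`, if the corruption probability `p` is below
`cos φ/(1 + cos φ)`, the normalized subgradient method with step sizes `γ_t = γ/t`,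
`γ = R/(2((1-q) cos φ - q))`, satisfies `E[‖x_{T+1} - x⋆(x_{T+1})‖²] ≤ γ²(1 + log T)/T`
and `‖x_t - x⋆(x_t)‖² → 0` almost surely. (The convention `∇f/‖∇f‖ = 0` when `∇f = 0`
in the weak pseudo-convexity inequality is built in, since `0⁻¹ = 0` in `ℝ`.) -/
theorem nsm_weakly_pseudoconvex
    {d : ℕ} {Ω : Type*} {mΩ : MeasurableSpace Ω}
    (μprob : Measure Ω) [IsProbabilityMeasure μprob]
    -- the constraint set: compact, convex, diameter at most `R`
    (X : Set (EuclideanSpace ℝ (Fin d))) (hXne : X.Nonempty)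
    (hXcompact : IsCompact X) (hXconv : Convex ℝ X)
    (R : ℝ) (hR : 0 < R)
    (hdiam : ∀ x₁ ∈ X, ∀ x₂ ∈ X, ‖x₁ - x₂‖ ≤ R)
    -- the objective: differentiable, with nonempty set `S` of minimizers over `X`
    (f : EuclideanSpace ℝ (Fin d) → ℝ)
    (hdiff : ∀ z ∈ X, DifferentiableAt ℝ f z)
    (S : Set (EuclideanSpace ℝ (Fin d)))
    (hS : S = {y ∈ X | ∀ z ∈ X, f y ≤ f z}) (hSne : S.Nonempty)
    -- `xstar z` is the minimizer nearest to `z`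
    (xstar : EuclideanSpace ℝ (Fin d) → EuclideanSpace ℝ (Fin d))
    (hxstarS : ∀ z, xstar z ∈ S)
    (hxstar_near : ∀ z, ∀ y ∈ S, ‖z - xstar z‖ ≤ ‖z - y‖)
    (hxstar_meas : Measurable xstar)
    -- weak pseudo-convexity with constant `K`
    (K : ℝ) (hK : 0 < K)
    (hwpc : ∀ z ∈ X,
      f z - f (xstar z) ≤ K * ⟪‖gradient f z‖⁻¹ • gradient f z, z - xstar z⟫_ℝ)
    -- the acute angle condition with constant `cos φ`, `φ ∈ [0, π/2)`
    (φ : ℝ) (hφ0 : 0 ≤ φ) (hφ1 : φ < Real.pi / 2)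
    (hacute : ∀ z ∈ X,
      Real.cos φ * ‖gradient f z‖ * ‖z - xstar z‖ ≤ ⟪gradient f z, z - xstar z⟫_ℝ)
    -- corruption probability and step-size parameters
    (p q γ : ℝ) (hp0 : 0 ≤ p) (hpq : p ≤ q)
    (hq : q < Real.cos φ / (1 + Real.cos φ))
    (hγ : γ = R / (2 * ((1 - q) * Real.cos φ - q)))
    -- Euclidean projection onto `X`
    (proj : EuclideanSpace ℝ (Fin d) → EuclideanSpace ℝ (Fin d))
    (hprojX : ∀ z, proj z ∈ X)
    (hproj_near : ∀ z, ∀ y ∈ X, ‖proj z - z‖ ≤ ‖y - z‖)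
    -- the iterates, feedback, corruptions and corruption indicators
    (x h b : ℕ → Ω → EuclideanSpace ℝ (Fin d)) (Y : ℕ → Ω → Bool)
    (hxmeas : ∀ t, Measurable (x t)) (hbmeas : ∀ t, Measurable (b t))
    (hYmeas : ∀ t, Measurable (Y t))
    (hx1 : ∀ ω, x 1 ω ∈ X)
    -- the received feedback: corrupted with probability `p`
    (hfeed : ∀ t ω, h t ω = if Y t ω = true then b t ω else gradient f (x t ω))
    (hYp : ∀ t, μprob {ω | Y t ω = true} = ENNReal.ofReal p)
    (hYindep : ∀ t, IndepFun (Y t) (x t) μprob)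
    -- the normalized subgradient update with step size `γ/t`
    (hupdate : ∀ t : ℕ, 1 ≤ t → ∀ ω,
      x (t + 1) ω =
        if h t ω ≠ 0 then
          proj (x t ω - ((γ / (t : ℝ)) * ‖h t ω‖⁻¹) • h t ω)
        else x t ω) :
    (∀ T : ℕ, 1 ≤ T →
      ∫ ω, ‖x (T + 1) ω - xstar (x (T + 1) ω)‖ ^ 2 ∂μprob ≤
        γ ^ 2 * (1 + Real.log T) / T) ∧
    (∀ᵐ ω ∂μprob,
      Tendsto (fun t => ‖x t ω - xstar (x t ω)‖ ^ 2) atTop (𝓝 0)) := by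
  have hcos : 0 < Real.cos φ := Real.cos_pos_of_mem_Ioo ⟨by linarith [Real.pi_pos], hφ1⟩
  have hc : 0 < (1 - q) * Real.cos φ - q := by
    rw [lt_div_iff₀ (by linarith)] at hq
    linarith
  have hγ0 : 0 < γ := hγ ▸ by positivity
  have hγR : 2 * γ * ((1 - q) * Real.cos φ - q) = R := by
    rw [hγ]
    field_simp
  have hSX : S ⊆ X := by
    rw [hS]
    exact fun y hy => hy.1
  have hproj_self : ∀ z ∈ X, proj z = z := fun z hz => by
    have h0 := hproj_near z z hz
    rw [sub_self, norm_zero] at h0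
    exact sub_eq_zero.1 (norm_le_zero_iff.1 h0)
  have hmem_succ : ∀ n ω, x (n + 1) ω ∈ X := by
    intro n ω
    induction n with
    | zero => exact hx1 ω
    | succ n ih =>
      rw [hupdate (n + 1) (by omega) ω]
      split_ifs
      exacts [hprojX _, ih]
  have hmem : ∀ t, 1 ≤ t → ∀ ω, x t ω ∈ X := fun t ht ω => by
    obtain ⟨n, rfl⟩ := Nat.exists_eq_add_of_le' ht
    exact hmem_succ n ω
  have hupdate' : ∀ t, 1 ≤ t → ∀ ω,
      x (t + 1) ω = proj (x t ω - (γ / (t : ℝ)) • (‖h t ω‖⁻¹ • h t ω)) := fun t ht ω => by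
    rw [hupdate t ht ω, mul_smul]
    split_ifs with h0
    · rfl
    · rw [not_not.1 h0, smul_zero, smul_zero, sub_zero, hproj_self _ (hmem t ht ω)]
  have hcontract : ∀ t, 1 ≤ t → ∀ ω, ∀ y ∈ X,
      ‖x (t + 1) ω - y‖ ≤ ‖x t ω - (γ / (t : ℝ)) • (‖h t ω‖⁻¹ • h t ω) - y‖ :=
    fun t ht ω y hy => by
      rw [hupdate' t ht ω]
      exact norm_proj_sub_le_of_mem hXconv (hprojX _) (hproj_near _) hy
  have hγt : ∀ t : ℕ, 0 ≤ γ / (t : ℝ) := fun t => by positivity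
  set u : ℕ → Ω → ℝ := fun t ω => ‖x t ω - xstar (x t ω)‖ with hu
  have hu0 : ∀ t ω, 0 ≤ u t ω := fun t ω => norm_nonneg _
  have hudist : Measurable fun z => ‖z - xstar z‖ := (measurable_id.sub hxstar_meas).norm
  have humeas : ∀ t, Measurable (u t) := fun t => hudist.comp (hxmeas t)
  have huR : ∀ t, 1 ≤ t → ∀ ω, u t ω ≤ R := fun t ht ω =>
    hdiam _ (hmem t ht ω) _ (hSX (hxstarS _))
  have hdir : ∀ t, 1 ≤ t → ∀ ω, (if Y t ω = true then -1 else Real.cos φ) * u t ω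
      ≤ ⟪‖h t ω‖⁻¹ • h t ω, x t ω - xstar (x t ω)⟫_ℝ := by
    intro t ht ω
    rw [hfeed]
    split_ifs with hY
    · have h1 := (abs_le.1 (abs_real_inner_le_norm (‖b t ω‖⁻¹ • b t ω)
        (x t ω - xstar (x t ω)))).1
      have h2 := mul_le_mul_of_nonneg_right (norm_inv_norm_smul_le_one (b t ω)) (hu0 t ω)
      linarith
    · have hX := hmem t ht ω
      rcases eq_or_ne (gradient f (x t ω)) 0 with hg | hg
      · -- a critical point is a minimizer by weak pseudo-convexity
        have hw := hwpc _ hX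
        rw [hg, smul_zero, inner_zero_left, mul_zero, sub_nonpos] at hw
        have hxS : x t ω ∈ S := by
          have hs := hxstarS (x t ω)
          rw [hS] at hs ⊢
          exact ⟨hX, fun z hz => hw.trans (hs.2 z hz)⟩
        have hd := hxstar_near (x t ω) _ hxS
        rw [sub_self, norm_zero] at hd
        have hu_zero : u t ω = 0 := le_antisymm hd (hu0 t ω)
        rw [hu_zero, hg, smul_zero, inner_zero_left, mul_zero]
      · have hgpos := norm_pos_iff.2 hg
        rw [real_inner_smul_left, ← div_eq_inv_mul, le_div_iff₀ hgpos]
        have := hacute _ hX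
        simp only [hu]
        linarith
  have hstep : ∀ t, 1 ≤ t → ∀ ω, u (t + 1) ω ^ 2 ≤ u t ω ^ 2
      - 2 * (γ / t) * ((if Y t ω = true then -1 else Real.cos φ) * u t ω) + (γ / t) ^ 2 :=
    fun t ht ω => by
      refine le_trans (pow_le_pow_left₀ (hu0 _ _) ?_ 2)
        (norm_sub_smul_sub_sq_le (hγt t) (norm_inv_norm_smul_le_one (h t ω)) (hdir t ht ω))
      exact (hxstar_near _ _ (hxstarS (x t ω))).trans
        (hcontract t ht ω _ (hSX (hxstarS _)))
  have hbdd : ∀ t, 1 ≤ t → ∀ {m : Ω → ℝ}, Measurable m → (∀ ω, |m ω| ≤ 1) → ∀ k : ℕ,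
      Integrable (fun ω => m ω * u t ω ^ k) μprob := fun t ht m hm hm1 k => by
    refine Integrable.of_bound (C := R ^ k)
      (hm.mul ((humeas t).pow_const k)).aestronglyMeasurable (ae_of_all _ fun ω => ?_)
    rw [Real.norm_eq_abs, abs_mul, abs_of_nonneg (pow_nonneg (hu0 t ω) k)]
    calc |m ω| * u t ω ^ k ≤ 1 * R ^ k :=
          mul_le_mul (hm1 ω) (pow_le_pow_left₀ (hu0 t ω) (huR t ht ω) k)
            (pow_nonneg (hu0 t ω) k) zero_le_one
      _ = R ^ k := one_mul _
  have hint_pow : ∀ t, 1 ≤ t → ∀ k : ℕ, Integrable (fun ω => u t ω ^ k) μprob :=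
    fun t ht k => by
      simpa using hbdd t ht (m := fun _ => 1) measurable_const (by simp) k
  have hrec : ∀ t : ℕ, 1 ≤ t → ∫ ω, u (t + 1) ω ^ 2 ∂μprob
      ≤ (1 - 1 / (t : ℝ)) * ∫ ω, u t ω ^ 2 ∂μprob + γ ^ 2 / (t : ℝ) ^ 2 := by
    intro t ht
    have htpos : (0 : ℝ) < t := by exact_mod_cast ht
    have hsign : Integrable
        (fun ω => (if Y t ω = true then -1 else Real.cos φ) * u t ω) μprob := by
      have hm : Measurable fun ω => if Y t ω = true then -1 else Real.cos φ :=
        Measurable.ite (hYmeas t (measurableSet_singleton true)) measurable_const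
          measurable_const
      refine (hbdd t ht hm (fun ω => ?_) 1).congr (ae_of_all _ fun ω => by simp)
      split_ifs
      exacts [by simp, Real.abs_cos_le_one φ]
    have hE := integral_bernoulli_mul (hYmeas t) (humeas t)
      ((hYindep t).comp measurable_id hudist) hp0 (hYp t) (-1) (Real.cos φ)
    have hdecr : Integrable (fun ω => u t ω ^ 2
        - 2 * (γ / t) * ((if Y t ω = true then -1 else Real.cos φ) * u t ω)) μprob :=
      (hint_pow t ht 2).sub (hsign.const_mul _)
    have hmono := integral_mono (hint_pow (t + 1) (by omega) 2)
      (hdecr.add (integrable_const ((γ / t) ^ 2))) (hstep t ht)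
    have hI2 : ∫ ω, u t ω ^ 2 ∂μprob ≤ R * ∫ ω, u t ω ∂μprob := by
      rw [← integral_const_mul]
      refine integral_mono (hint_pow t ht 2) ?_ fun ω => ?_
      · simpa using (hint_pow t ht 1).const_mul R
      · simp only [pow_two]
        exact mul_le_mul_of_nonneg_right (huR t ht ω) (hu0 t ω)
    have hsplit : ∫ ω, (u t ω ^ 2
          - 2 * (γ / t) * ((if Y t ω = true then -1 else Real.cos φ) * u t ω)
          + (γ / t) ^ 2) ∂μprob
        = ∫ ω, u t ω ^ 2 ∂μprob - 2 * (γ / t) *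
          ((p * (-1) + (1 - p) * Real.cos φ) * ∫ ω, u t ω ∂μprob) + (γ / t) ^ 2 := by
      rw [integral_add hdecr (integrable_const _),
        integral_sub (hint_pow t ht 2) (hsign.const_mul _), integral_const_mul, hE]
      simp
    have hI1 : 0 ≤ ∫ ω, u t ω ∂μprob := integral_nonneg (hu0 t)
    have hpc : (1 - q) * Real.cos φ - q ≤ p * (-1) + (1 - p) * Real.cos φ := by
      nlinarith
    have hdrift : (∫ ω, u t ω ^ 2 ∂μprob) / t ≤ 2 * (γ / t) *
        ((p * (-1) + (1 - p) * Real.cos φ) * ∫ ω, u t ω ∂μprob) := by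
      have h1 : R * ∫ ω, u t ω ∂μprob ≤ 2 * γ *
          ((p * (-1) + (1 - p) * Real.cos φ) * ∫ ω, u t ω ∂μprob) := by
        rw [← hγR, mul_assoc]
        gcongr
      rw [← mul_div_assoc, div_mul_eq_mul_div]
      exact div_le_div_of_nonneg_right (hI2.trans h1) htpos.le
    have hmono' := hmono.trans_eq hsplit
    rw [div_pow] at hmono'
    rw [sub_mul, one_mul, one_div_mul_eq_div]
    linarith
  have hrate : ∀ T : ℕ, 1 ≤ T →
      ∫ ω, u (T + 1) ω ^ 2 ∂μprob ≤ γ ^ 2 * (1 + Real.log T) / T := fun T hT =>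
    le_one_add_log_div_of_recursion (a := fun t => ∫ ω, u t ω ^ 2 ∂μprob) (sq_nonneg γ) hrec hT
  refine ⟨hrate, ?_⟩
  have hinc : ∀ (n : ℕ) ω, |u (n + 1 + 1) ω - u (n + 1) ω| ≤ γ / (n + 1) := fun n ω => by
    refine (abs_norm_sub_nearest_sub_le hxstarS hxstar_near _ _).trans
      ((hcontract (n + 1) (by omega) ω _ (hmem_succ n ω)).trans ?_)
    rw [sub_sub_cancel_left, norm_neg, norm_smul, Real.norm_of_nonneg (hγt _)]
    push_cast
    exact mul_le_of_le_one_right (by positivity) (norm_inv_norm_smul_le_one _)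
  filter_upwards [ae_tendsto_zero_of_increments_of_integral_sq_le
    (v := fun n => u (n + 1)) (fun n => hu0 _) hγ0.le (fun n => hint_pow _ (by omega) 2)
    hinc hrate] with ω hω
  simpa using ((tendsto_add_atTop_iff_nat (f := fun t => u t ω) 1).1 hω).pow 2
end
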